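/- (Risk-tail sub-additivity.) Let X and Y be integrable random variables. Suppose there exists an integrable random variable X* with S(U_β^φ(X*)) = 1 such that X ≥ X* almost surely and Y ≥ X* almost surely. Then SlideVaR_{α,β}^φ(X + Y) ≤ SlideVaR_{α,β}^φ(X) + SlideVaR_{α,β}^φ(Y). -/

import Mathlib

open MeasureTheory

/-- Quantile function `F_X^{-1}(p) = inf {x : F_X(x) >= p}` of the loss `X` under `P`. -/
noncomputable def quantile {Ω : Type*} [MeasurableSpace Ω] (P : Measure Ω)
    (X : Ω → ℝ) (p : ℝ) : ℝ :=
  sInf {x : ℝ | p ≤ (P {ω | X ω ≤ x}).toReal}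

/-- Tail thickness `U_β^φ(X) = ∫_0^1 F_X^{-1}(p) φ_β(p) dp`. -/
noncomputable def tailThickness {Ω : Type*} [MeasurableSpace Ω] (P : Measure Ω)
    (φ : ℝ → ℝ) (X : Ω → ℝ) : ℝ :=
  ∫ p in (0:ℝ)..1, quantile P X p * φ p

/-- Value at risk `VaR_α(X) = F_X^{-1}(α)`. -/
noncomputable def VaR {Ω : Type*} [MeasurableSpace Ω] (P : Measure Ω)
    (α : ℝ) (X : Ω → ℝ) : ℝ :=
  quantile P X α

/-- Conditional value at risk `CVaR_α(X) = (1/(1-α)) ∫_α^1 F_X^{-1}(p) dp`. -/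
noncomputable def CVaR {Ω : Type*} [MeasurableSpace Ω] (P : Measure Ω)
    (α : ℝ) (X : Ω → ℝ) : ℝ :=
  (1 / (1 - α)) * ∫ p in α..1, quantile P X p

/-- `SlideVaR_{α,β}^φ(X) = S(U_β^φ(X))·CVaR_α(X) + (1 - S(U_β^φ(X)))·VaR_β(X)`. -/
noncomputable def SlideVaR {Ω : Type*} [MeasurableSpace Ω] (P : Measure Ω)
    (α β : ℝ) (φ S : ℝ → ℝ) (X : Ω → ℝ) : ℝ :=
  S (tailThickness P φ X) * CVaR P α X
    + (1 - S (tailThickness P φ X)) * VaR P β X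
section Quantile

variable {Ω : Type*} [MeasurableSpace Ω] {P : Measure Ω} [IsProbabilityMeasure P]
  {X Y : Ω → ℝ} {p α β : ℝ} {φ : ℝ → ℝ}

lemma toReal_measure_le_eq_cdf (hX : AEMeasurable X P) (x : ℝ) :
    (P {ω | X ω ≤ x}).toReal = ProbabilityTheory.cdf (P.map X) x := by
  have := Measure.isProbabilityMeasure_map hX
  rw [ProbabilityTheory.cdf_eq_real, measureReal_def,
    Measure.map_apply_of_aemeasurable hX measurableSet_Iic]
  rfl

lemma nonempty_quantile_set (hX : AEMeasurable X P) (hp : p < 1) :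
    {x : ℝ | p ≤ (P {ω | X ω ≤ x}).toReal}.Nonempty := by
  simp only [toReal_measure_le_eq_cdf hX]
  obtain ⟨x, hx⟩ :=
    ((ProbabilityTheory.tendsto_cdf_atTop (P.map X)).eventually_const_lt hp).exists
  exact ⟨x, hx.le⟩

lemma bddBelow_quantile_set (hX : AEMeasurable X P) (hp : 0 < p) :
    BddBelow {x : ℝ | p ≤ (P {ω | X ω ≤ x}).toReal} := by
  simp only [toReal_measure_le_eq_cdf hX]
  obtain ⟨x, hx⟩ :=
    ((ProbabilityTheory.tendsto_cdf_atBot (P.map X)).eventually_lt_const hp).exists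
  refine ⟨x, fun y hy => ?_⟩
  by_contra! h
  exact (hx.trans_le hy).not_ge (ProbabilityTheory.monotone_cdf _ h.le)

/-- The quantile function is the generalized inverse of the distribution function. -/
lemma quantile_le_iff (hX : AEMeasurable X P) (hp : p ∈ Set.Ioo (0 : ℝ) 1) (x : ℝ) :
    quantile P X p ≤ x ↔ p ≤ ProbabilityTheory.cdf (P.map X) x := by
  constructor
  · intro h
    have hright := ((ProbabilityTheory.cdf (P.map X)).right_continuous x).mono
      Set.Ioi_subset_Ici_self
    refine ge_of_tendsto hright ?_
    filter_upwards [self_mem_nhdsWithin] with y hy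
    obtain ⟨z, hz, hzy⟩ := exists_lt_of_csInf_lt (nonempty_quantile_set hX hp.2)
      (h.trans_lt hy)
    rw [Set.mem_ofPred_eq, toReal_measure_le_eq_cdf hX] at hz
    exact hz.trans (ProbabilityTheory.monotone_cdf _ hzy.le)
  · intro h
    refine csInf_le (bddBelow_quantile_set hX hp.1) ?_
    rwa [Set.mem_ofPred_eq, toReal_measure_le_eq_cdf hX]

lemma quantile_monotoneOn (hX : AEMeasurable X P) :
    MonotoneOn (quantile P X) (Set.Ioo 0 1) := fun _ hp _ hq hpq =>
  csInf_le_csInf (bddBelow_quantile_set hX hp.1) (nonempty_quantile_set hX hq.2)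
    fun _ hx => hpq.trans hx

lemma quantile_mono_ae (hX : AEMeasurable X P) (hY : AEMeasurable Y P)
    (hXY : ∀ᵐ ω ∂P, X ω ≤ Y ω) (hp : p ∈ Set.Ioo (0 : ℝ) 1) :
    quantile P X p ≤ quantile P Y p := by
  refine csInf_le_csInf (bddBelow_quantile_set hX hp.1) (nonempty_quantile_set hY hp.2)
    fun x hx => ?_
  rw [Set.mem_ofPred_eq] at hx ⊢
  refine hx.trans (ENNReal.toReal_mono (measure_ne_top _ _) (measure_mono_ae ?_))
  filter_upwards [hXY] with ω hω hy
  exact hω.trans hy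

lemma aemeasurable_quantile (hX : AEMeasurable X P) :
    AEMeasurable (quantile P X) (volume.restrict (Set.Ioo 0 1)) :=
  aemeasurable_restrict_of_monotoneOn measurableSet_Ioo (quantile_monotoneOn hX)

/-- The quantile function of `X`, under the uniform law on `(0, 1)`, has the law of `X`. -/
lemma map_quantile (hX : AEMeasurable X P) :
    (volume.restrict (Set.Ioo (0 : ℝ) 1)).map (quantile P X) = P.map X := by
  have := Measure.isProbabilityMeasure_map hX
  refine Measure.ext_of_Iic _ _ fun x => ?_
  rw [Measure.map_apply_of_aemeasurable (aemeasurable_quantile hX) measurableSet_Iic,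
    ← ProbabilityTheory.ofReal_cdf, Measure.restrict_apply' measurableSet_Ioo]
  have hset : quantile P X ⁻¹' Set.Iic x ∩ Set.Ioo 0 1
      = Set.Iic (ProbabilityTheory.cdf (P.map X) x) ∩ Set.Ioo 0 1 := by
    ext p
    simp only [Set.mem_inter_iff, Set.mem_preimage, Set.mem_Iic]
    exact and_congr_left fun hp => quantile_le_iff hX hp x
  have hae : (Set.Iic (ProbabilityTheory.cdf (P.map X) x) ∩ Set.Ioo 0 1 : Set ℝ)
      =ᵐ[volume] (Set.Iic (ProbabilityTheory.cdf (P.map X) x) ∩ Set.Ioc 0 1 : Set ℝ) :=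
    (Filter.EventuallyEq.refl _ _).inter Ioo_ae_eq_Ioc
  rw [hset, measure_congr hae, Set.inter_comm, Set.Ioc_inter_Iic, Real.volume_Ioc,
    min_eq_right (ProbabilityTheory.cdf_le_one _ x), sub_zero]

lemma integrableOn_comp_quantile (hX : AEMeasurable X P) {f : ℝ → ℝ} (hf : Measurable f)
    (hfX : Integrable (fun ω => f (X ω)) P) :
    IntegrableOn (fun p => f (quantile P X p)) (Set.Ioo 0 1) := by
  have h : Integrable f (P.map X) :=
    (integrable_map_measure hf.aestronglyMeasurable hX).2 hfX
  rw [← map_quantile hX] at h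
  exact (integrable_map_measure hf.aestronglyMeasurable (aemeasurable_quantile hX)).1 h

lemma integral_comp_quantile (hX : AEMeasurable X P) {f : ℝ → ℝ} (hf : Measurable f) :
    ∫ p in Set.Ioo 0 1, f (quantile P X p) = ∫ ω, f (X ω) ∂P := by
  rw [← integral_map hX hf.aestronglyMeasurable, ← map_quantile hX,
    integral_map (aemeasurable_quantile hX) hf.aestronglyMeasurable]

lemma integrableOn_quantile (hX : Integrable X P) :
    IntegrableOn (quantile P X) (Set.Ioo 0 1) :=
  integrableOn_comp_quantile hX.aemeasurable measurable_id hX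

lemma integral_quantile_sub_const (hX : Integrable X P) (hα0 : 0 < α) (hα : α < 1) (t : ℝ) :
    ∫ p in Set.Ioo α 1, (quantile P X p - t) = (∫ p in α..1, quantile P X p) - (1 - α) * t := by
  rw [integral_sub
    ((integrableOn_quantile hX).mono_set (Set.Ioo_subset_Ioo_left hα0.le)) (by simp),
    intervalIntegral.integral_of_le hα.le, integral_Ioc_eq_integral_Ioo]
  simp [hα.le]

/-- Every threshold gives an upper bound in the Rockafellar-Uryasev formula. -/
lemma integral_quantile_le (hX : Integrable X P) (hα0 : 0 < α) (hα : α < 1) (t : ℝ) :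
    ∫ p in α..1, quantile P X p ≤ (1 - α) * t + ∫ ω, max (X ω - t) 0 ∂P := by
  have hf : Measurable fun x : ℝ => max (x - t) 0 := by fun_prop
  have hpos : Integrable (fun ω => max (X ω - t) 0) P := (hX.sub (integrable_const t)).pos_part
  have hintq := integrableOn_comp_quantile hX.aemeasurable hf hpos
  have hsub : Set.Ioo α 1 ⊆ Set.Ioo 0 1 := Set.Ioo_subset_Ioo_left hα0.le
  have h1 : ∫ p in Set.Ioo α 1, (quantile P X p - t)
      ≤ ∫ p in Set.Ioo α 1, max (quantile P X p - t) 0 :=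
    integral_mono (((integrableOn_quantile hX).mono_set hsub).sub (by simp))
      (hintq.mono_set hsub) fun p => le_max_left _ _
  have h2 : ∫ p in Set.Ioo α 1, max (quantile P X p - t) 0
      ≤ ∫ p in Set.Ioo 0 1, max (quantile P X p - t) 0 :=
    setIntegral_mono_set hintq (Filter.Eventually.of_forall fun p => le_max_right _ _)
      hsub.eventuallyLE
  rw [integral_quantile_sub_const hX hα0 hα] at h1
  rw [integral_comp_quantile hX.aemeasurable hf] at h2
  linarith

/-- The quantile at level `α` attains the Rockafellar-Uryasev formula. -/
lemma integral_quantile_eq (hX : Integrable X P) (hα0 : 0 < α) (hα : α < 1) :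
    ∫ p in α..1, quantile P X p
      = (1 - α) * quantile P X α + ∫ ω, max (X ω - quantile P X α) 0 ∂P := by
  have hf : Measurable fun x : ℝ => max (x - quantile P X α) 0 := by fun_prop
  have hsub : Set.Ioo α 1 ⊆ Set.Ioo 0 1 := Set.Ioo_subset_Ioo_left hα0.le
  have hmono := quantile_monotoneOn hX.aemeasurable
  have h1 : ∫ p in Set.Ioo α 1, (quantile P X p - quantile P X α)
      = ∫ p in Set.Ioo α 1, max (quantile P X p - quantile P X α) 0 :=
    setIntegral_congr_fun measurableSet_Ioo fun p hp =>
      (max_eq_left (sub_nonneg.2 (hmono ⟨hα0, hα⟩ (hsub hp) hp.1.le))).symm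
  have h2 : ∫ p in Set.Ioo 0 1, max (quantile P X p - quantile P X α) 0
      = ∫ p in Set.Ioo α 1, max (quantile P X p - quantile P X α) 0 :=
    setIntegral_eq_of_subset_of_forall_sdiff_eq_zero measurableSet_Ioo hsub fun p hp =>
      max_eq_right (sub_nonpos.2 (hmono hp.1 ⟨hα0, hα⟩
        (not_lt.1 fun h => hp.2 ⟨h, hp.1.2⟩)))
  rw [integral_quantile_sub_const hX hα0 hα] at h1
  rw [integral_comp_quantile hX.aemeasurable hf] at h2
  linarith

lemma CVaR_add_le (hX : Integrable X P) (hY : Integrable Y P) (hα0 : 0 < α) (hα : α < 1) :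
    CVaR P α (fun ω => X ω + Y ω) ≤ CVaR P α X + CVaR P α Y := by
  unfold CVaR
  rw [← mul_add]
  refine mul_le_mul_of_nonneg_left ?_ (one_div_nonneg.2 (sub_nonneg.2 hα.le))
  have h := integral_quantile_le (hX.add hY) hα0 hα (quantile P X α + quantile P Y α)
  have hXint : Integrable (fun ω => max (X ω - quantile P X α) 0) P :=
    (hX.sub (integrable_const _)).pos_part
  have hYint : Integrable (fun ω => max (Y ω - quantile P Y α) 0) P :=
    (hY.sub (integrable_const _)).pos_part
  have hle : ∫ ω, max ((X + Y) ω - (quantile P X α + quantile P Y α)) 0 ∂P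
      ≤ ∫ ω, (max (X ω - quantile P X α) 0 + max (Y ω - quantile P Y α) 0) ∂P := by
    refine integral_mono ((hX.add hY).sub (integrable_const _)).pos_part
      (hXint.add hYint) fun ω => max_le ?_ (by positivity)
    have hx := le_max_left (X ω - quantile P X α) 0
    have hy := le_max_left (Y ω - quantile P Y α) 0
    simp only [Pi.add_apply]
    linarith
  rw [integral_add hXint hYint] at hle
  rw [integral_quantile_eq hX hα0 hα, integral_quantile_eq hY hα0 hα]
  change ∫ p in α..1, quantile P (X + Y) p ≤ _
  linarith

lemma VaR_le_CVaR (hX : Integrable X P) (hβ : 0 < β) (hβα : β ≤ α) (hα : α < 1) :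
    VaR P β X ≤ CVaR P α X := by
  have hα0 := hβ.trans_le hβα
  have hmono : VaR P β X ≤ quantile P X α :=
    quantile_monotoneOn hX.aemeasurable ⟨hβ, hβα.trans_lt hα⟩ ⟨hα0, hα⟩ hβα
  refine hmono.trans ?_
  have hnonneg : 0 ≤ ∫ ω, max (X ω - quantile P X α) 0 ∂P :=
    integral_nonneg fun ω => le_max_right _ _
  rw [CVaR, one_div_mul_eq_div, le_div_iff₀ (sub_pos.2 hα), integral_quantile_eq hX hα0 hα]
  linarith

lemma tailThickness_mono (hφ : MonotoneOn φ (Set.Icc 0 1))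
    (hφ0 : ∀ p ∈ Set.Icc (0 : ℝ) 1, 0 ≤ φ p)
    (hX : Integrable X P) (hY : Integrable Y P) (hXY : ∀ᵐ ω ∂P, X ω ≤ Y ω) :
    tailThickness P φ X ≤ tailThickness P φ Y := by
  have hmeas : AEStronglyMeasurable φ (volume.restrict (Set.Ioo 0 1)) :=
    (aemeasurable_restrict_of_monotoneOn measurableSet_Ioo
      (hφ.mono Set.Ioo_subset_Icc_self)).aestronglyMeasurable
  have hbound : ∀ᵐ p ∂volume.restrict (Set.Ioo (0 : ℝ) 1), ‖φ p‖ ≤ φ 1 := by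
    refine ae_restrict_of_forall_mem measurableSet_Ioo fun p hp => ?_
    have hp' := Set.Ioo_subset_Icc_self hp
    rw [Real.norm_of_nonneg (hφ0 p hp')]
    exact hφ hp' (Set.right_mem_Icc.2 zero_le_one) hp.2.le
  unfold tailThickness
  simp only [intervalIntegral.integral_of_le zero_le_one, integral_Ioc_eq_integral_Ioo]
  refine setIntegral_mono_on ((integrableOn_quantile hX).mul_bdd hmeas hbound)
    ((integrableOn_quantile hY).mul_bdd hmeas hbound) measurableSet_Ioo fun p hp => ?_
  exact mul_le_mul_of_nonneg_right
    (quantile_mono_ae hX.aemeasurable hY.aemeasurable hXY hp)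
    (hφ0 p (Set.Ioo_subset_Icc_self hp))

end Quantile

theorem slideVaR_riskTail_subadditivity
    {Ω : Type*} [MeasurableSpace Ω] (P : Measure Ω) [IsProbabilityMeasure P]
    (α β : ℝ) (hβ : 0 < β) (hβα : β ≤ α) (hα : α < 1) (φ : ℝ → ℝ)
    (hφ0 : ∀ p ∈ Set.Ico (0:ℝ) β, φ p = 0)
    (hφpos : ∀ p ∈ Set.Icc β 1, 0 ≤ φ p)
    (hφmono : MonotoneOn φ (Set.Icc β 1))
    (hφnorm : ∫ p in (0:ℝ)..1, φ p = 1)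
    (S : ℝ → ℝ) (hS : Monotone S) (hS01 : ∀ x, S x ∈ Set.Icc (0:ℝ) 1)
    (X Y : Ω → ℝ) (hX : Integrable X P) (hY : Integrable Y P)
    (hstar : ∃ Xstar : Ω → ℝ, Integrable Xstar P ∧ S (tailThickness P φ Xstar) = 1 ∧
      (∀ᵐ ω ∂P, Xstar ω ≤ X ω) ∧ (∀ᵐ ω ∂P, Xstar ω ≤ Y ω)) :
    SlideVaR P α β φ S (fun ω => X ω + Y ω)
      ≤ SlideVaR P α β φ S X + SlideVaR P α β φ S Y := by
  obtain ⟨Z, hZ, hSZ, hZX, hZY⟩ := hstar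
  have hφnonneg : ∀ p ∈ Set.Icc (0 : ℝ) 1, 0 ≤ φ p := fun p hp => by
    rcases lt_or_ge p β with h | h
    · exact (hφ0 p ⟨hp.1, h⟩).ge
    · exact hφpos p ⟨h, hp.2⟩
  have hφ : MonotoneOn φ (Set.Icc 0 1) := fun p hp q hq hpq => by
    rcases lt_or_ge p β with h | h
    · rw [hφ0 p ⟨hp.1, h⟩]
      exact hφnonneg q hq
    · exact hφmono ⟨h, hp.2⟩ ⟨h.trans hpq, hq.2⟩ hpq
  have hslide : ∀ W : Ω → ℝ, Integrable W P → (∀ᵐ ω ∂P, Z ω ≤ W ω) →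
      SlideVaR P α β φ S W = CVaR P α W := fun W hW hZW => by
    have hSW : S (tailThickness P φ W) = 1 :=
      le_antisymm (hS01 _).2 (hSZ ▸ hS (tailThickness_mono hφ hφnonneg hZ hW hZW))
    simp [SlideVaR, hSW]
  rw [hslide X hX hZX, hslide Y hY hZY]
  refine le_trans ?_ (CVaR_add_le hX hY (hβ.trans_le hβα) hα)
  have hle := VaR_le_CVaR (hX.add hY) hβ hβα hα
  change SlideVaR P α β φ S (X + Y) ≤ CVaR P α (X + Y)
  unfold SlideVaR
  nlinarith [(hS01 (tailThickness P φ (X + Y))).2]
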